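/- Every real Banach space X of dimension at least 3 can be equivalently renormed to fail the self-extension property: there exist a real Banach space E and a continuous linear equivalence (linear homeomorphism) between X and E such that E does not have the self-extension property. -/

import Mathlib

universe u

/-- A real Banach space `X` has the **self-extension property** if every continuous linear
operator on a closed subspace of `X` extends to an operator on `X` with the same norm. -/
def SelfExt (X : Type*) [NormedAddCommGroup X] [NormedSpace ℝ X] : Prop :=
  ∀ (Y : Submodule ℝ X), IsClosed (Y : Set X) → ∀ T : Y →L[ℝ] Y,
    ∃ S : X →L[ℝ] X, (∀ y : Y, S y = (T y : X)) ∧ ‖S‖ = ‖T‖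

open Module

/-- The self-extension property passes to a factor of a product with the supremum norm. -/
theorem SelfExt.fst {F Z : Type*} [NormedAddCommGroup F] [NormedSpace ℝ F]
    [NormedAddCommGroup Z] [NormedSpace ℝ Z] (h : SelfExt (F × Z)) : SelfExt F := by
  intro Y hY T
  let Y' : Submodule ℝ (F × Z) := Y.prod ⊥
  have hY' : IsClosed (Y' : Set (F × Z)) := by
    simpa [Y', Submodule.prod_coe] using hY.prod (isClosed_singleton (x := (0 : Z)))
  let p : Y' →L[ℝ] Y :=
    ((ContinuousLinearMap.fst ℝ F Z).comp Y'.subtypeL).codRestrict Y fun y => y.2.1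
  let i : Y →L[ℝ] Y' :=
    ((ContinuousLinearMap.inl ℝ F Z).comp Y.subtypeL).codRestrict Y' fun y =>
      ⟨y.2, Submodule.zero_mem _⟩
  obtain ⟨S, hS, hnorm⟩ := h Y' hY' (i.comp (T.comp p))
  have hle : ‖i.comp (T.comp p)‖ ≤ ‖T‖ := by
    refine ContinuousLinearMap.opNorm_le_bound _ (ContinuousLinearMap.opNorm_nonneg _) fun y => ?_
    have hi : ‖i (T (p y))‖ = ‖T (p y)‖ := by
      change ‖((T (p y) : F), (0 : Z))‖ = ‖(T (p y) : F)‖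
      simp
    have hp : ‖p y‖ ≤ ‖y‖ := norm_fst_le (y : F × Z)
    calc ‖i (T (p y))‖ = ‖T (p y)‖ := hi
      _ ≤ ‖T‖ * ‖p y‖ := T.le_opNorm _
      _ ≤ ‖T‖ * ‖y‖ := by gcongr
  have hext : ∀ y : Y, (S ((y : F), (0 : Z))).1 = (T y : F) := fun y =>
    congrArg Prod.fst (hS (i y))
  refine ⟨(ContinuousLinearMap.fst ℝ F Z).comp (S.comp (ContinuousLinearMap.inl ℝ F Z)),
    hext, le_antisymm ?_ ?_⟩
  · refine ContinuousLinearMap.opNorm_le_bound _ (ContinuousLinearMap.opNorm_nonneg _) fun x => ?_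
    calc ‖(S (x, 0)).1‖ ≤ ‖S (x, 0)‖ := norm_fst_le _
      _ ≤ ‖S‖ * ‖(x, (0 : Z))‖ := S.le_opNorm _
      _ = ‖S‖ * ‖x‖ := by simp
      _ ≤ ‖T‖ * ‖x‖ := by rw [hnorm]; gcongr
  · refine ContinuousLinearMap.opNorm_le_bound _ (ContinuousLinearMap.opNorm_nonneg _) fun y => ?_
    calc ‖T y‖ = ‖((ContinuousLinearMap.fst ℝ F Z).comp
          (S.comp (ContinuousLinearMap.inl ℝ F Z))) (y : F)‖ := congrArg norm (hext y).symm
      _ ≤ _ := ContinuousLinearMap.le_opNorm _ _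

/-- The space `ℝ³`, to be normed by
`max (|a|, |b|, |a + b|, |a / 2 + b|, |c|, |c + 2 * a|)`. -/
def PolyhedralSpace : Type := Fin 3 → ℝ

namespace PolyhedralSpace

noncomputable instance : AddCommGroup PolyhedralSpace := inferInstanceAs (AddCommGroup (Fin 3 → ℝ))

noncomputable instance : Module ℝ PolyhedralSpace := inferInstanceAs (Module ℝ (Fin 3 → ℝ))

instance : FiniteDimensional ℝ PolyhedralSpace :=
  inferInstanceAs (FiniteDimensional ℝ (Fin 3 → ℝ))

theorem finrank_eq : finrank ℝ PolyhedralSpace = 3 := finrank_fin_fun ℝ (n := 3)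

/-- The functionals whose maximal absolute value is the norm of `PolyhedralSpace`. -/
noncomputable def functionals : PolyhedralSpace →ₗ[ℝ] (Fin 6 → ℝ) where
  toFun v := ![v 0, v 1, v 0 + v 1, v 0 / 2 + v 1, v 2, v 2 + 2 * v 0]
  map_add' v w := by
    have h : ∀ i, (v + w) i = v i + w i := fun _ => rfl
    ext i
    fin_cases i <;> simp [h] <;> ring
  map_smul' r v := by
    have h : ∀ i, (r • v) i = r * v i := fun _ => rfl
    ext i
    fin_cases i <;> simp [h] <;> ring

theorem functionals_injective : Function.Injective functionals := by
  intro v w h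
  have h0 : v 0 = w 0 := congrFun h 0
  have h1 : v 1 = w 1 := congrFun h 1
  have h2 : v 2 = w 2 := congrFun h 4
  refine funext fun i => ?_
  fin_cases i <;> assumption

noncomputable instance : NormedAddCommGroup PolyhedralSpace :=
  NormedAddCommGroup.induced PolyhedralSpace (Fin 6 → ℝ) functionals functionals_injective

noncomputable instance : NormedSpace ℝ PolyhedralSpace :=
  NormedSpace.induced ℝ PolyhedralSpace (Fin 6 → ℝ) functionals

theorem norm_le_iff {v : PolyhedralSpace} {r : ℝ} (hr : 0 ≤ r) :
    ‖v‖ ≤ r ↔ |v 0| ≤ r ∧ |v 1| ≤ r ∧ |v 0 + v 1| ≤ r ∧ |v 0 / 2 + v 1| ≤ r ∧ |v 2| ≤ r ∧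
      |v 2 + 2 * v 0| ≤ r := by
  change ‖functionals v‖ ≤ r ↔ _
  rw [pi_norm_le_iff_of_nonneg hr]
  simp [Fin.forall_fin_succ, functionals]

/-- A plane in `PolyhedralSpace` with an isometry that has no extension of norm one. -/
noncomputable def plane : Submodule ℝ PolyhedralSpace where
  carrier := {v | v 2 = -(5 / 4) * v 0 - v 1 / 2}
  add_mem' {v w} hv hw := by
    change v 2 + w 2 = -(5 / 4) * (v 0 + w 0) - (v 1 + w 1) / 2
    rw [Set.mem_ofPred_eq] at hv hw
    rw [hv, hw]
    ring
  zero_mem' := by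
    change (0 : ℝ) = -(5 / 4) * 0 - 0 / 2
    norm_num
  smul_mem' r v hv := by
    change r * v 2 = -(5 / 4) * (r * v 0) - (r * v 1) / 2
    rw [Set.mem_ofPred_eq] at hv
    rw [hv]
    ring

theorem mem_plane {v : PolyhedralSpace} : v ∈ plane ↔ v 2 = -(5 / 4) * v 0 - v 1 / 2 := Iff.rfl

/-- A linear map on the plane whose square is `-1`. -/
noncomputable def quarterTurn : plane →ₗ[ℝ] plane where
  toFun v := ⟨(![v.1 0 / 2 + v.1 1, v.1 2, -v.1 1] : Fin 3 → ℝ), by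
    have hv := mem_plane.1 v.2
    change -v.1 1 = -(5 / 4) * (v.1 0 / 2 + v.1 1) - v.1 2 / 2
    rw [hv]
    ring⟩
  map_add' v w := by
    have h : ∀ i, (v + w).1 i = v.1 i + w.1 i := fun _ => rfl
    refine Subtype.ext (funext fun i => ?_)
    change _ = (![_, _, _] : Fin 3 → ℝ) i + (![_, _, _] : Fin 3 → ℝ) i
    fin_cases i <;> simp [h] <;> ring
  map_smul' r v := by
    have h : ∀ i, (r • v).1 i = r * v.1 i := fun _ => rfl
    refine Subtype.ext (funext fun i => ?_)
    change _ = r * (![_, _, _] : Fin 3 → ℝ) i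
    fin_cases i <;> simp [h]
    ring

theorem norm_quarterTurn_le (v : plane) : ‖quarterTurn v‖ ≤ 1 * ‖v‖ := by
  rw [one_mul]
  have hv := mem_plane.1 v.2
  obtain ⟨h0, h1, h2, h3, h4, h5⟩ := (norm_le_iff (norm_nonneg v.1)).1 le_rfl
  refine (norm_le_iff (norm_nonneg v.1)).2 ?_
  change |v.1 0 / 2 + v.1 1| ≤ _ ∧ |v.1 2| ≤ _ ∧ |v.1 0 / 2 + v.1 1 + v.1 2| ≤ _ ∧
    |(v.1 0 / 2 + v.1 1) / 2 + v.1 2| ≤ _ ∧ |-v.1 1| ≤ _ ∧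
    |-v.1 1 + 2 * (v.1 0 / 2 + v.1 1)| ≤ _
  rw [abs_le] at *
  simp only [abs_le]
  refine ⟨h3, h4, ?_, ?_, ?_, ?_⟩ <;> constructor <;> linarith

theorem not_selfExt : ¬ SelfExt PolyhedralSpace := by
  intro h
  obtain ⟨S, hS, hnorm⟩ := h plane plane.closed_of_finiteDimensional
    (quarterTurn.mkContinuous 1 norm_quarterTurn_le)
  have hS1 : ‖S‖ ≤ 1 := hnorm.trans_le (quarterTurn.mkContinuous_norm_le zero_le_one _)
  have hball : ∀ v : PolyhedralSpace, ‖v‖ ≤ 1 → ‖S v‖ ≤ 1 := fun v hv =>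
    S.le_of_opNorm_le_of_le hS1 hv |>.trans_eq (one_mul 1)
  let e : PolyhedralSpace := (![-1, 1, 1] : Fin 3 → ℝ)
  let b : plane := ⟨(![1, -2, -1 / 4] : Fin 3 → ℝ), by
    change (-1 / 4 : ℝ) = -(5 / 4) * 1 - (-2) / 2
    norm_num⟩
  let c : plane := ⟨(![2, -1, -2] : Fin 3 → ℝ), by
    change (-2 : ℝ) = -(5 / 4) * 2 - (-1) / 2
    norm_num⟩
  have he : ‖e‖ ≤ 1 := by
    refine (norm_le_iff zero_le_one).2 ?_
    have h0 : e 0 = -1 := rfl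
    have h1 : e 1 = 1 := rfl
    have h2 : e 2 = 1 := rfl
    simp only [h0, h1, h2, abs_le]
    norm_num
  have heb : ‖e + b‖ ≤ 1 := by
    refine (norm_le_iff zero_le_one).2 ?_
    have h0 : (e + b) 0 = 0 := by change (-1 : ℝ) + 1 = 0; norm_num
    have h1 : (e + b) 1 = -1 := by change (1 : ℝ) + -2 = -1; norm_num
    have h2 : (e + b) 2 = 3 / 4 := by change (1 : ℝ) + -1 / 4 = 3 / 4; norm_num
    simp only [h0, h1, h2, abs_le]
    norm_num
  have hec : ‖e + c‖ ≤ 1 := by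
    refine (norm_le_iff zero_le_one).2 ?_
    have h0 : (e + c) 0 = 1 := by change (-1 : ℝ) + 2 = 1; norm_num
    have h1 : (e + c) 1 = 0 := by change (1 : ℝ) + -1 = 0; norm_num
    have h2 : (e + c) 2 = -1 := by change (1 : ℝ) + -2 = -1; norm_num
    simp only [h0, h1, h2, abs_le]
    norm_num
  have hSe := ((norm_le_iff zero_le_one).1 (hball _ he)).2.2.1
  have hSb := ((norm_le_iff zero_le_one).1 (hball _ heb)).1
  have hSc := ((norm_le_iff zero_le_one).1 (hball _ hec)).2.1
  rw [map_add, hS] at hSb hSc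
  change |S e 0 + (1 / 2 + -2)| ≤ 1 at hSb
  change |S e 1 + -2| ≤ 1 at hSc
  rw [abs_le] at hSe hSb hSc
  linarith [hSe.2, hSb.1, hSc.1]

end PolyhedralSpace

/-- Every real Banach space of dimension at least `3` can be equivalently renormed (i.e. there
is a real Banach space linearly homeomorphic to it) so as to fail the self-extension
property. -/
theorem exists_renorming_failing_selfExt (X : Type u) [NormedAddCommGroup X]
    [NormedSpace ℝ X] [CompleteSpace X] (h : 3 ≤ Module.rank ℝ X) :
    ∃ (E : Type u) (_ : NormedAddCommGroup E) (_ : NormedSpace ℝ E) (_ : CompleteSpace E),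
      Nonempty (X ≃L[ℝ] E) ∧ ¬ SelfExt E := by
  obtain ⟨f, hf⟩ := (le_rank_iff_exists_linearMap (R := ℝ) (M := X) (n := 3)).1
    (by exact_mod_cast h)
  have hW : finrank ℝ f.range = finrank ℝ PolyhedralSpace := by
    rw [LinearMap.finrank_range_of_inj hf, finrank_fin_fun, PolyhedralSpace.finrank_eq]
  have hcompl := Submodule.ClosedComplemented.of_finiteDimensional f.range
  let Z := hcompl.complement
  have : CompleteSpace Z := hcompl.isClosed_complement.completeSpace_coe
  have : CompleteSpace PolyhedralSpace := FiniteDimensional.complete ℝ _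
  exact ⟨PolyhedralSpace × Z, inferInstance, inferInstance, inferInstance,
    ⟨(f.range.prodEquivOfIsTopCompl Z hcompl.isTopCompl_complement).symm.trans
      ((ContinuousLinearEquiv.ofFinrankEq hW).prodCongr (.refl ℝ Z))⟩,
    fun hE => PolyhedralSpace.not_selfExt hE.fst⟩
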